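/- Assume f satisfies (f1), (f2) with B > 0, and (f3), and let u₁ and u₂ be two positive solutions of the exterior problem (R) with b = ∞ such that 0 < u₁'(a) < u₂'(a). If r̄₁(M₁) < r̄₂(M₁), then r̄₁ and r̄₂ intersect in (0, M₁), i.e. there exists s ∈ (0, M₁) with r̄₁(s) = r̄₂(s). -/

import Mathlib

open Set Filter MeasureTheory

/-- `F(s) = ∫₀ˢ f(t) dt`. -/
noncomputable def Fint (f : ℝ → ℝ) (s : ℝ) : ℝ := ∫ t in (0:ℝ)..s, f t

/-- Condition (f1): `f` is continuous on `[0,∞)`, continuously differentiable on `(0,∞)`,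
and `f' ∈ L¹(0,1)`. -/
def CondF1 (f : ℝ → ℝ) : Prop :=
  ContinuousOn f (Ici 0) ∧ (∀ s ∈ Ioi (0:ℝ), DifferentiableAt ℝ f s) ∧
  ContinuousOn (deriv f) (Ioi 0) ∧ IntervalIntegrable (deriv f) volume 0 1

/-- Condition (f2) in the case `β > B > 0`. -/
def CondF2B (f : ℝ → ℝ) (β B : ℝ) : Prop :=
  f 0 = 0 ∧ 0 < B ∧ B < β ∧ (∀ s, B < s → 0 < f s) ∧
  (∀ s ∈ Icc (0:ℝ) B, f s ≤ 0) ∧ (∃ ε > (0:ℝ), ∀ s ∈ Ioo (0:ℝ) ε, f s < 0) ∧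
  Fint f β = 0

/-- Condition (f2): either `β = B = 0` and `f > 0` on `(0,∞)`, or `β > B > 0` with the
sign conditions and `F(β) = 0`. -/
def CondF2 (f : ℝ → ℝ) (β B : ℝ) : Prop :=
  (β = 0 ∧ B = 0 ∧ f 0 = 0 ∧ ∀ s, 0 < s → 0 < f s) ∨ CondF2B f β B

/-- Condition (f3): the derivative of `s ↦ F(s)/f(s)` is `≥ (n-2)/(2n)` for every `s > β`. -/
def CondF3 (n : ℕ) (f : ℝ → ℝ) (β : ℝ) : Prop :=
  ∀ s, β < s → ∃ d, ((n : ℝ) - 2) / (2 * (n : ℝ)) ≤ d ∧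
    HasDerivAt (fun t => Fint f t / f t) d s

/-- Condition (f4): superlinearity `f(s) ≤ f'(s)(s - B)` for `s > B`, with
`f(s) ≢ f'(s)(s - B)` on `[B, β]`. -/
def CondF4 (f : ℝ → ℝ) (β B : ℝ) : Prop :=
  (∀ s, B < s → f s ≤ deriv f s * (s - B)) ∧
  ¬ (∀ s ∈ Icc B β, f s = deriv f s * (s - B))

/-- A positive solution of problem (R) on the annulus `a < |x| < b`:
`u` is continuous on `[a,b]`, differentiable up to the boundary with derivative `u'`
(one-sided at the endpoints), `u'` is continuous on `[a,b]`, `u` is twice continuously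
differentiable on `(a,b)` where it satisfies `u'' + ((n-1)/r) u' + f(u) = 0`,
`u(a) = u(b) = 0` and `u > 0` on `(a,b)`. -/
def IsPosSolAnn (n : ℕ) (a b : ℝ) (f u u' : ℝ → ℝ) : Prop :=
  ContinuousOn u (Icc a b) ∧
  (∀ r ∈ Icc a b, HasDerivWithinAt u (u' r) (Icc a b) r) ∧
  ContinuousOn u' (Icc a b) ∧
  (∀ r ∈ Ioo a b, HasDerivAt u (u' r) r) ∧
  (∀ r ∈ Ioo a b, HasDerivAt u' (-(((n : ℝ) - 1) / r * u' r + f (u r))) r) ∧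
  u a = 0 ∧ u b = 0 ∧ (∀ r ∈ Ioo a b, 0 < u r)

/-- A positive solution of the exterior problem (R) with `b = ∞`:
`u` is continuous on `[a,∞)`, differentiable on `[a,∞)` with derivative `u'`
(one-sided at `a`), twice continuously differentiable on `(a,∞)` where it satisfies
`u'' + ((n-1)/r) u' + f(u) = 0`, `u(a) = 0`, `u > 0` on `(a,∞)` and `u(r) → 0` as `r → ∞`. -/
def IsPosSolExt (n : ℕ) (a : ℝ) (f u u' : ℝ → ℝ) : Prop :=
  ContinuousOn u (Ici a) ∧
  (∀ r ∈ Ici a, HasDerivWithinAt u (u' r) (Ici a) r) ∧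
  (∀ r ∈ Ioi a, HasDerivAt u (u' r) r) ∧
  (∀ r ∈ Ioi a, HasDerivAt u' (-(((n : ℝ) - 1) / r * u' r + f (u r))) r) ∧
  u a = 0 ∧ (∀ r ∈ Ioi a, 0 < u r) ∧
  Tendsto u atTop (nhds 0)

/-- The Erbe–Tang functional
`P(s) = -2n (F(s)/f(s)) ρ(s)^{n-1} u'(ρ(s)) - ρ(s)^n (u'(ρ(s)))² - 2 ρ(s)^n F(s)`,
where `ρ` is an inverse branch of the solution `u` with derivative `u'`. -/
noncomputable def Pfun (n : ℕ) (f : ℝ → ℝ) (ρ u' : ℝ → ℝ) (s : ℝ) : ℝ :=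
  -2 * (n : ℝ) * (Fint f s / f s) * (ρ s) ^ (n - 1) * u' (ρ s)
    - (ρ s) ^ n * (u' (ρ s)) ^ 2 - 2 * (ρ s) ^ n * Fint f s

lemma aux_cont2 (φ ψ φ' ψ' : ℝ → ℝ) (l h : ℝ) (hl : l ≤ h)
    (hφ : ∀ s ∈ Icc l h, HasDerivAt φ (φ' s) s) (hψ : ∀ s ∈ Icc l h, HasDerivAt ψ (ψ' s) s)
    (h1 : 0 < φ l) (h2 : 0 < ψ l)
    (H : ∀ s ∈ Icc l h, 0 < φ s → 0 < ψ s → 0 ≤ φ' s ∧ 0 ≤ ψ' s) :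
    0 < φ h ∧ 0 < ψ h ∧ φ l ≤ φ h ∧ ψ l ≤ ψ h := by
  have key : ∀ t ∈ Icc l h, (∀ s ∈ Ico l t, 0 < φ s ∧ 0 < ψ s) → φ l ≤ φ t ∧ ψ l ≤ ψ t := by
    intro t ht hs
    have m1 : MonotoneOn φ (Icc l t) := by
      apply monotoneOn_of_deriv_nonneg (convex_Icc _ _)
      · exact fun s hs' => (hφ s ⟨hs'.1, hs'.2.trans ht.2⟩).continuousAt.continuousWithinAt
      · rw [interior_Icc]
        exact fun s hs' => (hφ s ⟨hs'.1.le, hs'.2.le.trans ht.2⟩).differentiableAt.differentiableWithinAt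
      · rw [interior_Icc]
        intro s hs'
        have hm : s ∈ Icc l h := ⟨hs'.1.le, hs'.2.le.trans ht.2⟩
        rw [(hφ s hm).deriv]
        have := hs s ⟨hs'.1.le, hs'.2⟩
        exact (H s hm this.1 this.2).1
    have m2 : MonotoneOn ψ (Icc l t) := by
      apply monotoneOn_of_deriv_nonneg (convex_Icc _ _)
      · exact fun s hs' => (hψ s ⟨hs'.1, hs'.2.trans ht.2⟩).continuousAt.continuousWithinAt
      · rw [interior_Icc]
        exact fun s hs' => (hψ s ⟨hs'.1.le, hs'.2.le.trans ht.2⟩).differentiableAt.differentiableWithinAt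
      · rw [interior_Icc]
        intro s hs'
        have hm : s ∈ Icc l h := ⟨hs'.1.le, hs'.2.le.trans ht.2⟩
        rw [(hψ s hm).deriv]
        have := hs s ⟨hs'.1.le, hs'.2⟩
        exact (H s hm this.1 this.2).2
    exact ⟨m1 ⟨le_rfl, ht.1⟩ ⟨ht.1, le_rfl⟩ ht.1, m2 ⟨le_rfl, ht.1⟩ ⟨ht.1, le_rfl⟩ ht.1⟩
  have pos : ∀ s ∈ Icc l h, 0 < φ s ∧ 0 < ψ s := by
    by_contra hcon
    push Not at hcon
    obtain ⟨s, hs, hs'⟩ := hcon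
    have hcont : ContinuousOn (fun s => min (φ s) (ψ s)) (Icc l h) := fun x hx =>
      ContinuousAt.continuousWithinAt
        (Filter.Tendsto.min (hφ x hx).continuousAt (hψ x hx).continuousAt)
    have hclosed : IsClosed (Icc l h ∩ (fun s => min (φ s) (ψ s)) ⁻¹' Iic 0) :=
      hcont.preimage_isClosed_of_isClosed isClosed_Icc isClosed_Iic
    have hcomp : IsCompact (Icc l h ∩ (fun s => min (φ s) (ψ s)) ⁻¹' Iic 0) :=
      isCompact_Icc.of_isClosed_subset hclosed inter_subset_left
    have hne : (Icc l h ∩ (fun s => min (φ s) (ψ s)) ⁻¹' Iic 0).Nonempty := by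
      refine ⟨s, hs, ?_⟩
      simp only [mem_preimage, mem_Iic]
      by_cases h0 : 0 < φ s
      · exact (min_le_right _ _).trans (hs' h0)
      · exact (min_le_left _ _).trans (not_lt.1 h0)
    obtain ⟨t, ht, hleast⟩ := hcomp.exists_isLeast hne
    have := key t ht.1 (by
      intro x hx
      by_contra hx'
      have : t ≤ x := hleast ⟨⟨hx.1, hx.2.le.trans ht.1.2⟩, by
        simp only [mem_preimage, mem_Iic]
        by_contra h4
        push Not at h4
        exact hx' (lt_min_iff.1 h4)⟩
      exact absurd hx.2 (not_lt.2 this)) 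
    have h5 : min (φ t) (ψ t) ≤ 0 := ht.2
    have h6 : 0 < min (φ t) (ψ t) := lt_min (h1.trans_le this.1) (h2.trans_le this.2)
    linarith
  have := key h ⟨hl, le_rfl⟩ (fun s hs => pos s ⟨hs.1, hs.2.le⟩)
  exact ⟨h1.trans_le this.1, h2.trans_le this.2, this.1, this.2⟩

/-- backward version for one function -/
lemma aux_back (φ φ' : ℝ → ℝ) (l h : ℝ) (hl : l ≤ h)
    (hφ : ∀ s ∈ Icc l h, HasDerivAt φ (φ' s) s) (h1 : 0 < φ h)
    (H : ∀ s ∈ Icc l h, 0 < φ s → φ' s ≤ 0) : φ h ≤ φ l := by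
  have hd : ∀ s ∈ Icc (-h) (-l), HasDerivAt (fun s => φ (-s)) (-φ' (-s)) s := by
    intro s hs
    have := (hφ (-s) ⟨by linarith [hs.2], by linarith [hs.1]⟩).scomp s (hasDerivAt_neg s)
    simpa [Function.comp_def] using this
  have := aux_cont2 (fun s => φ (-s)) (fun s => φ (-s)) (fun s => -φ' (-s)) (fun s => -φ' (-s))
    (-h) (-l) (by linarith) hd hd (by simpa using h1) (by simpa using h1) (by
      intro s hs h0 _
      have := H (-s) ⟨by linarith [hs.2], by linarith [hs.1]⟩ h0
      constructor <;> linarith)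
  simpa using this.2.2.1

/-- comparison on the increasing branches -/
lemma aux_inc (k : ℕ) (f F ρ₁ p₁ ρ₂ p₂ : ℝ → ℝ) (m β s₁ : ℝ)
    (hF : ∀ s ∈ Ioo 0 m, HasDerivAt F (f s) s)
    (hβm : β < m) (hFn : ∀ s ∈ Ioc 0 β, F s ≤ 0) (hFβ : F β = 0)
    (hfp : ∀ s, β ≤ s → 0 ≤ f s)
    (r1 : ∀ s ∈ Ioo 0 m, 0 < ρ₁ s) (r2 : ∀ s ∈ Ioo 0 m, 0 < ρ₂ s)
    (q1 : ∀ s ∈ Ioo 0 m, 0 < p₁ s) (q2 : ∀ s ∈ Ioo 0 m, 0 < p₂ s)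
    (dr1 : ∀ s ∈ Ioo 0 m, HasDerivAt ρ₁ (1 / p₁ s) s)
    (dr2 : ∀ s ∈ Ioo 0 m, HasDerivAt ρ₂ (1 / p₂ s) s)
    (dp1 : ∀ s ∈ Ioo 0 m, HasDerivAt p₁ (-(((k : ℝ) + 1) / ρ₁ s + f s / p₁ s)) s)
    (dp2 : ∀ s ∈ Ioo 0 m, HasDerivAt p₂ (-(((k : ℝ) + 1) / ρ₂ s + f s / p₂ s)) s)
    (e1 : ∀ s ∈ Ioo 0 m, 0 ≤ p₁ s ^ 2 / 2 + F s)
    (hs₁ : s₁ ∈ Ioo 0 β) (hr : ρ₂ s₁ < ρ₁ s₁)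
    (he : ρ₁ s₁ ^ (2 * k + 2) * (p₁ s₁ ^ 2 / 2 + F s₁)
        < ρ₂ s₁ ^ (2 * k + 2) * (p₂ s₁ ^ 2 / 2 + F s₁)) :
    ∃ η > 0, ∀ s ∈ Ioo β m, η ≤ ρ₂ s ^ (2 * k + 2) * p₂ s ^ 2 := by
  have dE : ∀ (ρ p : ℝ → ℝ), (∀ s ∈ Ioo 0 m, 0 < ρ s) → (∀ s ∈ Ioo 0 m, 0 < p s) →
      (∀ s ∈ Ioo 0 m, HasDerivAt ρ (1 / p s) s) →
      (∀ s ∈ Ioo 0 m, HasDerivAt p (-(((k : ℝ) + 1) / ρ s + f s / p s)) s) →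
      ∀ s ∈ Ioo 0 m, HasDerivAt (fun s => ρ s ^ (2 * k + 2) * (p s ^ 2 / 2 + F s))
        ((2 * k + 2) * ρ s ^ (2 * k + 1) * F s / p s) s := by
    intro ρ p hρ hp dρ dp s hs
    have h1 := ((dρ s hs).pow (2 * k + 2)).mul ((((dp s hs).pow 2).div_const 2).add (hF s hs))
    refine h1.congr_deriv ?_
    have a1 := (hρ s hs).ne'
    have a2 := (hp s hs).ne'
    simp only [Pi.pow_apply, Pi.add_apply, show 2 * k + 2 - 1 = 2 * k + 1 by omega]
    push_cast
    field_simp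
    ring
  have dQ : ∀ (ρ p : ℝ → ℝ), (∀ s ∈ Ioo 0 m, 0 < ρ s) → (∀ s ∈ Ioo 0 m, 0 < p s) →
      (∀ s ∈ Ioo 0 m, HasDerivAt ρ (1 / p s) s) →
      (∀ s ∈ Ioo 0 m, HasDerivAt p (-(((k : ℝ) + 1) / ρ s + f s / p s)) s) →
      ∀ s ∈ Ioo 0 m, HasDerivAt (fun s => ρ s ^ (2 * k + 2) * p s ^ 2)
        (-2 * ρ s ^ (2 * k + 2) * f s) s := by
    intro ρ p hρ hp dρ dp s hs
    have h1 := ((dρ s hs).pow (2 * k + 2)).mul ((dp s hs).pow 2)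
    refine h1.congr_deriv ?_
    have a1 := (hρ s hs).ne'
    have a2 := (hp s hs).ne'
    simp only [Pi.pow_apply, show 2 * k + 2 - 1 = 2 * k + 1 by omega]
    push_cast
    field_simp
    ring
  have sub1 : ∀ s ∈ Icc s₁ β, s ∈ Ioo 0 m := fun s hs =>
    ⟨hs₁.1.trans_le hs.1, hs.2.trans_lt hβm⟩
  have st1 := aux_cont2 (fun s => ρ₁ s - ρ₂ s)
    (fun s => ρ₂ s ^ (2 * k + 2) * (p₂ s ^ 2 / 2 + F s) - ρ₁ s ^ (2 * k + 2) * (p₁ s ^ 2 / 2 + F s))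
    (fun s => 1 / p₁ s - 1 / p₂ s)
    (fun s => (2 * k + 2) * ρ₂ s ^ (2 * k + 1) * F s / p₂ s
      - (2 * k + 2) * ρ₁ s ^ (2 * k + 1) * F s / p₁ s) s₁ β hs₁.2.le
    (fun s hs => (dr1 s (sub1 s hs)).sub (dr2 s (sub1 s hs)))
    (fun s hs => (dE ρ₂ p₂ r2 q2 dr2 dp2 s (sub1 s hs)).sub (dE ρ₁ p₁ r1 q1 dr1 dp1 s (sub1 s hs)))
    (by simpa using hr) (by simpa using he) (by
      intro s hs hφ hψ
      have hs' := sub1 s hs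
      have hρ1 := r1 s hs'
      have hρ2 := r2 s hs'
      have hp1 := q1 s hs'
      have hp2 := q2 s hs'
      have hρ : ρ₂ s ≤ ρ₁ s := by linarith
      have hE := e1 s hs'
      have hFs : F s ≤ 0 := hFn s ⟨hs'.1, hs.2⟩
      have h3 : p₁ s ≤ p₂ s := by
        by_contra hlt
        push Not at hlt
        have h4 : p₂ s ^ 2 / 2 + F s ≤ p₁ s ^ 2 / 2 + F s := by
          have : p₂ s ^ 2 ≤ p₁ s ^ 2 := by gcongr
          linarith
        have h5 : ρ₂ s ^ (2 * k + 2) ≤ ρ₁ s ^ (2 * k + 2) := by gcongr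
        have h6 : ρ₂ s ^ (2 * k + 2) * (p₂ s ^ 2 / 2 + F s)
            ≤ ρ₁ s ^ (2 * k + 2) * (p₁ s ^ 2 / 2 + F s) :=
          (mul_le_mul_of_nonneg_left h4 (by positivity)).trans
            (mul_le_mul_of_nonneg_right h5 hE)
        linarith
      constructor
      · have : 1 / p₂ s ≤ 1 / p₁ s := by gcongr
        linarith
      · have : (2 * k + 2) * ρ₂ s ^ (2 * k + 1) * (-F s) / p₂ s
            ≤ (2 * k + 2) * ρ₁ s ^ (2 * k + 1) * (-F s) / p₁ s := by
          have : 0 ≤ -F s := by linarith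
          gcongr
        have e1 : (2 * k + 2) * ρ₂ s ^ (2 * k + 1) * (-F s) / p₂ s
          = -((2 * k + 2) * ρ₂ s ^ (2 * k + 1) * (F s) / p₂ s) := by ring
        have e2 : (2 * k + 2) * ρ₁ s ^ (2 * k + 1) * (-F s) / p₁ s
          = -((2 * k + 2) * ρ₁ s ^ (2 * k + 1) * (F s) / p₁ s) := by ring
        rw [e1, e2] at this
        linarith)
  obtain ⟨s1, s2, -, -⟩ := st1
  simp only [hFβ, add_zero] at s2
  have hβ0 : 0 < β := hs₁.1.trans hs₁.2
  refine ⟨ρ₂ β ^ (2 * k + 2) * p₂ β ^ 2 - ρ₁ β ^ (2 * k + 2) * p₁ β ^ 2, by linarith, ?_⟩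
  intro t ht
  have sub2 : ∀ s ∈ Icc β t, s ∈ Ioo 0 m := fun s hs =>
    ⟨hβ0.trans_le hs.1, hs.2.trans_lt ht.2⟩
  have st2 := aux_cont2 (fun s => ρ₁ s - ρ₂ s)
    (fun s => ρ₂ s ^ (2 * k + 2) * p₂ s ^ 2 - ρ₁ s ^ (2 * k + 2) * p₁ s ^ 2)
    (fun s => 1 / p₁ s - 1 / p₂ s)
    (fun s => (-2 * ρ₂ s ^ (2 * k + 2) * f s) - (-2 * ρ₁ s ^ (2 * k + 2) * f s)) β t ht.1.le
    (fun s hs => (dr1 s (sub2 s hs)).sub (dr2 s (sub2 s hs)))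
    (fun s hs => (dQ ρ₂ p₂ r2 q2 dr2 dp2 s (sub2 s hs)).sub (dQ ρ₁ p₁ r1 q1 dr1 dp1 s (sub2 s hs)))
    s1 (by linarith) (by
      intro s hs hφ hψ
      have hs' := sub2 s hs
      have hρ1 := r1 s hs'
      have hρ2 := r2 s hs'
      have hp1 := q1 s hs'
      have hp2 := q2 s hs'
      have hρ : ρ₂ s ≤ ρ₁ s := by linarith
      have hfs := hfp s hs.1
      have h5 : ρ₂ s ^ (2 * k + 2) ≤ ρ₁ s ^ (2 * k + 2) := by gcongr
      have h3 : p₁ s ≤ p₂ s := by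
        by_contra hlt
        push Not at hlt
        have h6 : ρ₂ s ^ (2 * k + 2) * p₂ s ^ 2 ≤ ρ₁ s ^ (2 * k + 2) * p₁ s ^ 2 := by gcongr
        linarith
      constructor
      · have : 1 / p₂ s ≤ 1 / p₁ s := by gcongr
        linarith
      · nlinarith)
  have h7 := st2.2.2.2
  have h8 : 0 ≤ ρ₁ t ^ (2 * k + 2) * p₁ t ^ 2 := by
    have := r1 t (sub2 t ⟨ht.1.le, le_rfl⟩)
    positivity
  linarith

/-- comparison on the decreasing branches -/
lemma aux_dec (k : ℕ) (f ρ₁ p₁ ρ₂ p₂ : ℝ → ℝ) (m B : ℝ)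
    (hB : 0 < B) (hBm : B < m) (hfn : ∀ s ∈ Ioc 0 B, f s ≤ 0)
    (r1 : ∀ s ∈ Ioo 0 m, 0 < ρ₁ s) (r12 : ∀ s ∈ Ioo 0 m, ρ₁ s < ρ₂ s)
    (q1 : ∀ s ∈ Ioo 0 m, 0 < p₁ s) (q2 : ∀ s ∈ Ioo 0 m, 0 < p₂ s)
    (dr1 : ∀ s ∈ Ioo 0 m, HasDerivAt ρ₁ (-(1 / p₁ s)) s)
    (dr2 : ∀ s ∈ Ioo 0 m, HasDerivAt ρ₂ (-(1 / p₂ s)) s)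
    (dp1 : ∀ s ∈ Ioo 0 m, HasDerivAt p₁ (((k : ℝ) + 1) / ρ₁ s - f s / p₁ s) s)
    (dp2 : ∀ s ∈ Ioo 0 m, HasDerivAt p₂ (((k : ℝ) + 1) / ρ₂ s - f s / p₂ s) s)
    (hlim : ∀ η > 0, ∀ δ > 0, ∃ s ∈ Ioo 0 δ, p₂ s < η ∧ 1 ≤ ρ₂ s) :
    ∃ η > 0, ∀ s ∈ Ioo B m, η ≤ p₁ s ^ 2 := by
  have r2 : ∀ s ∈ Ioo 0 m, 0 < ρ₂ s := fun s hs => (r1 s hs).trans (r12 s hs)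
  have dZ : ∀ (ρ p : ℝ → ℝ), (∀ s ∈ Ioo 0 m, 0 < ρ s) → (∀ s ∈ Ioo 0 m, 0 < p s) →
      (∀ s ∈ Ioo 0 m, HasDerivAt ρ (-(1 / p s)) s) →
      (∀ s ∈ Ioo 0 m, HasDerivAt p (((k : ℝ) + 1) / ρ s - f s / p s) s) →
      ∀ s ∈ Ioo 0 m, HasDerivAt (fun s => p s / ρ s)
        (((k + 2) + (-f s) / (p s / ρ s)) / ρ s ^ 2) s := by
    intro ρ p hρ hp dρ dp s hs
    have a1 := (hρ s hs).ne'
    have a2 := (hp s hs).ne'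
    have h1 := (dp s hs).div (dρ s hs) a1
    refine h1.congr_deriv ?_
    field_simp
    ring
  have dP : ∀ (ρ p : ℝ → ℝ), (∀ s ∈ Ioo 0 m, 0 < ρ s) → (∀ s ∈ Ioo 0 m, 0 < p s) →
      (∀ s ∈ Ioo 0 m, HasDerivAt p (((k : ℝ) + 1) / ρ s - f s / p s) s) →
      ∀ s ∈ Ioo 0 m, HasDerivAt (fun s => p s ^ 2)
        (2 * (k + 1) * (p s / ρ s) - 2 * f s) s := by
    intro ρ p hρ hp dp s hs
    have a1 := (hρ s hs).ne'
    have a2 := (hp s hs).ne'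
    have h1 := (dp s hs).pow 2
    refine h1.congr_deriv ?_
    push_cast
    field_simp
  have dPP : ∀ s ∈ Ioo 0 m, HasDerivAt (fun s => p₁ s ^ 2 - p₂ s ^ 2)
      (2 * (k + 1) * (p₁ s / ρ₁ s - p₂ s / ρ₂ s)) s := fun s hs =>
    ((dP ρ₁ p₁ r1 q1 dp1 s hs).sub (dP ρ₂ p₂ r2 q2 dp2 s hs)).congr_deriv (by ring)
  -- step 1
  have z12 : ∀ s ∈ Ioc 0 B, p₂ s / ρ₂ s ≤ p₁ s / ρ₁ s := by
    intro s₀ hs₀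
    by_contra hcon
    push Not at hcon
    set d := p₂ s₀ / ρ₂ s₀ - p₁ s₀ / ρ₁ s₀ with hd
    have hd0 : 0 < d := by linarith
    obtain ⟨s, hs, hps, hρs⟩ := hlim d hd0 s₀ hs₀.1
    have sub : ∀ x ∈ Icc s s₀, x ∈ Ioo 0 m := fun x hx =>
      ⟨hs.1.trans_le hx.1, (hx.2.trans hs₀.2).trans_lt hBm⟩
    have := aux_back (fun s => p₂ s / ρ₂ s - p₁ s / ρ₁ s) _ s s₀ hs.2.le
      (fun x hx => (dZ ρ₂ p₂ r2 q2 dr2 dp2 x (sub x hx)).sub (dZ ρ₁ p₁ r1 q1 dr1 dp1 x (sub x hx)))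
      hd0 (by
        intro x hx hpos
        have hx' := sub x hx
        have b1 := r1 x hx'
        have b2 := r12 x hx'
        have b3 := q1 x hx'
        have b4 := q2 x hx'
        have b5 : 0 ≤ -f x := by linarith [hfn x ⟨hx'.1, hx.2.trans hs₀.2⟩]
        have b6 : p₁ x / ρ₁ x ≤ p₂ x / ρ₂ x := by linarith
        have b7 : 0 < p₁ x / ρ₁ x := by positivity
        have b8 := r2 x hx'
        have : ((k + 2) + (-f x) / (p₂ x / ρ₂ x)) / ρ₂ x ^ 2
            ≤ ((k + 2) + (-f x) / (p₁ x / ρ₁ x)) / ρ₁ x ^ 2 := by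
          gcongr
        linarith)
    have hsm := sub s ⟨le_rfl, hs.2.le⟩
    have c1 : 0 < p₁ s / ρ₁ s := div_pos (q1 s hsm) (r1 s hsm)
    have c2 : p₂ s / ρ₂ s ≤ p₂ s := div_le_self (q2 s hsm).le hρs
    linarith
  -- step 2
  have sub : ∀ s ∈ Ioc 0 B, s ∈ Ioo 0 m := fun s hs => ⟨hs.1, hs.2.trans_lt hBm⟩
  have mono : MonotoneOn (fun s => p₁ s ^ 2 - p₂ s ^ 2) (Ioc 0 B) := by
    apply monotoneOn_of_deriv_nonneg (convex_Ioc _ _)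
    · exact fun s hs => (dPP s (sub s hs)).continuousAt.continuousWithinAt
    · rw [interior_Ioc]
      exact fun s hs => (dPP s (sub s ⟨hs.1, hs.2.le⟩)).differentiableAt.differentiableWithinAt
    · rw [interior_Ioc]
      intro s hs
      rw [(dPP s (sub s ⟨hs.1, hs.2.le⟩)).deriv]
      have := z12 s ⟨hs.1, hs.2.le⟩
      have : 0 ≤ p₁ s / ρ₁ s - p₂ s / ρ₂ s := by linarith
      positivity
  have p12 : ∀ s ∈ Ioc 0 B, 0 ≤ p₁ s ^ 2 - p₂ s ^ 2 := by
    intro s hs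
    by_contra hcon
    push Not at hcon
    obtain ⟨t, ht, hpt, hρt⟩ := hlim (Real.sqrt (-(p₁ s ^ 2 - p₂ s ^ 2)))
      (Real.sqrt_pos.2 (by linarith)) s hs.1
    have htB : t ∈ Ioc 0 B := ⟨ht.1, ht.2.le.trans hs.2⟩
    have := mono htB hs ht.2.le
    simp only at this
    have h2 := q2 t (sub t htB)
    have h3 : p₂ t ^ 2 < -(p₁ s ^ 2 - p₂ s ^ 2) := by
      rwa [Real.lt_sqrt h2.le] at hpt
    nlinarith [sq_nonneg (p₁ t)]
  have hz : ∀ s ∈ Ioo 0 m, 0 ≤ p₁ s ^ 2 - p₂ s ^ 2 → 0 < p₁ s / ρ₁ s - p₂ s / ρ₂ s := by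
    intro s hs h0
    have b1 := r1 s hs
    have b2 := r12 s hs
    have b3 := q1 s hs
    have b4 := q2 s hs
    have h1 : p₂ s ≤ p₁ s := by nlinarith
    have h2 : p₂ s / ρ₂ s < p₁ s / ρ₁ s := by
      rw [div_lt_div_iff₀ (r2 s hs) b1]
      nlinarith
    linarith
  have smono : StrictMonoOn (fun s => p₁ s ^ 2 - p₂ s ^ 2) (Ioc 0 B) := by
    apply strictMonoOn_of_deriv_pos (convex_Ioc _ _)
    · exact fun s hs => (dPP s (sub s hs)).continuousAt.continuousWithinAt
    · rw [interior_Ioc]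
      intro s hs
      rw [(dPP s (sub s ⟨hs.1, hs.2.le⟩)).deriv]
      have := hz s (sub s ⟨hs.1, hs.2.le⟩) (p12 s ⟨hs.1, hs.2.le⟩)
      positivity
  have hBpos : 0 < p₁ B ^ 2 - p₂ B ^ 2 :=
    (p12 (B / 2) ⟨by linarith, by linarith⟩).trans_lt
      (smono ⟨by linarith, by linarith⟩ ⟨hB, le_rfl⟩ (by linarith))
  refine ⟨_, hBpos, ?_⟩
  intro t ht
  have sub2 : ∀ s ∈ Icc B t, s ∈ Ioo 0 m := fun s hs => ⟨hB.trans_le hs.1, hs.2.trans_lt ht.2⟩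
  have := aux_cont2 (fun s => p₁ s ^ 2 - p₂ s ^ 2) (fun s => p₁ s ^ 2 - p₂ s ^ 2) _ _ B t ht.1.le
    (fun s hs => dPP s (sub2 s hs)) (fun s hs => dPP s (sub2 s hs)) hBpos hBpos (by
      intro s hs h0 _
      have := hz s (sub2 s hs) h0.le
      constructor <;> positivity)
  have := this.2.2.1
  nlinarith [sq_nonneg (p₂ t)]

/-- bundled data of a solution -/
structure AuxSol (k : ℕ) (a c : ℝ) (f F u u' : ℝ → ℝ) : Prop where
  ha : 0 < a
  hac : a < c
  hf : Continuous f
  hF : ∀ s, HasDerivAt F (f s) s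
  hF0 : F 0 = 0
  hcont : ContinuousOn u (Ici a)
  hda : HasDerivWithinAt u (u' a) (Ici a) a
  hd : ∀ r ∈ Ioi a, HasDerivAt u (u' r) r
  hdd : ∀ r ∈ Ioi a, HasDerivAt u' (-(((k : ℝ) + 1) / r * u' r + f (u r))) r
  hua : u a = 0
  hpos : ∀ r ∈ Ioi a, 0 < u r
  hlim : Tendsto u atTop (nhds 0)
  hup : ∀ r ∈ Ico a c, 0 < u' r
  hdown : ∀ r ∈ Ioi c, u' r < 0

namespace AuxSol

variable {k : ℕ} {a c : ℝ} {f F u u' : ℝ → ℝ}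

lemma dE (h : AuxSol k a c f F u u') (r : ℝ) (hr : a < r) :
    HasDerivAt (fun r => u' r ^ 2 / 2 + F (u r)) (-((k + 1) / r * u' r ^ 2)) r := by
  have h1 := (((h.hdd r hr).pow 2).div_const 2).add ((h.hF (u r)).comp r (h.hd r hr))
  refine h1.congr_deriv ?_
  push_cast
  ring

lemma Eanti (h : AuxSol k a c f F u u') :
    AntitoneOn (fun r => u' r ^ 2 / 2 + F (u r)) (Ioi a) := by
  apply antitoneOn_of_deriv_nonpos (convex_Ioi _)
  · exact fun s hs => (h.dE s hs).continuousAt.continuousWithinAt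
  · rw [interior_Ioi]
    exact fun s hs => (h.dE s hs).differentiableAt.differentiableWithinAt
  · rw [interior_Ioi]
    intro s hs
    rw [(h.dE s hs).deriv]
    have : 0 < s := h.ha.trans hs
    have : 0 ≤ (k + 1) / s * u' s ^ 2 := by positivity
    linarith

lemma Enonneg (h : AuxSol k a c f F u u') (r : ℝ) (hr : a < r) :
    0 ≤ u' r ^ 2 / 2 + F (u r) := by
  have h1 : Tendsto (fun r => F (u r)) atTop (nhds 0) := by
    have := (h.hF 0).continuousAt.tendsto.comp h.hlim
    rwa [h.hF0] at this
  refine ge_of_tendsto' (f := fun _ : ℝ => u' r ^ 2 / 2 + F (u r)) (x := atTop) tendsto_const_nhds ?_ |> fun x => x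
  intro _
  refine le_of_tendsto h1 ?_
  filter_upwards [eventually_ge_atTop r] with t ht
  have := h.Eanti hr (hr.trans_le ht) ht
  simp only at this
  nlinarith [sq_nonneg (u' t)]

lemma uc (h : AuxSol k a c f F u u') : u' c = 0 := by
  have hc : ContinuousAt u' c := (h.hdd c h.hac).continuousAt
  apply le_antisymm
  · refine le_of_tendsto (hc.tendsto.mono_left nhdsWithin_le_nhds : Tendsto u' (nhdsWithin c (Ioi c)) _) ?_
    filter_upwards [self_mem_nhdsWithin] with r hr using (h.hdown r hr).le
  · refine ge_of_tendsto (hc.tendsto.mono_left nhdsWithin_le_nhds : Tendsto u' (nhdsWithin c (Iio c)) _) ?_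
    filter_upwards [Ioo_mem_nhdsLT h.hac] with r hr using (h.hup r ⟨hr.1.le, hr.2⟩).le

lemma FM (h : AuxSol k a c f F u u') : 0 < F (u c) := by
  have h1 : StrictAntiOn (fun r => u' r ^ 2 / 2 + F (u r)) (Ici c) := by
    apply strictAntiOn_of_deriv_neg (convex_Ici _)
    · exact fun s hs => (h.dE s (h.hac.trans_le hs)).continuousAt.continuousWithinAt
    · rw [interior_Ici]
      intro s hs
      have hs' : a < s := h.hac.trans hs
      rw [(h.dE s hs').deriv]
      have h0 : 0 < s := h.ha.trans hs'
      have : 0 < u' s ^ 2 := by nlinarith [h.hdown s hs]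
      have : 0 < (k + 1) / s * u' s ^ 2 := by positivity
      linarith
  have h2 := h1 ((self_mem_Ici : c ∈ Ici c)) (show c + 1 ∈ Ici c by simp) (by linarith)
  simp only [h.uc] at h2
  have h3 := h.Enonneg (c + 1) (by linarith [h.hac])
  nlinarith

lemma liminf (h : AuxSol k a c f F u u') (η : ℝ) (hη : 0 < η) (δ : ℝ) (hδ : 0 < δ) :
    ∃ r, c < r ∧ 1 ≤ r ∧ u r < δ ∧ -u' r < η := by
  have h1 : ∀ᶠ r in atTop, u r < min δ η := h.hlim (Iio_mem_nhds (lt_min hδ hη))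
  obtain ⟨R, hR⟩ := eventually_atTop.1 h1
  set x := max (max R (c + 1)) 1 with hx
  have x1 : R ≤ x := (le_max_left _ _).trans (le_max_left _ _)
  have x2 : c + 1 ≤ x := (le_max_right _ _).trans (le_max_left _ _)
  have x3 : 1 ≤ x := le_max_right _ _
  have hac := h.hac
  obtain ⟨ξ, hξ, hξ'⟩ := exists_hasDerivAt_eq_slope u u' (show x < x + 1 by linarith)
    (fun r hr => (h.hd r (show a < r by linarith [hr.1])).continuousAt.continuousWithinAt)
    (fun r hr => h.hd r (show a < r by linarith [hr.1]))
  refine ⟨ξ, by linarith [hξ.1], by linarith [hξ.1], (hR ξ (by linarith [hξ.1])).trans_le (min_le_left _ _), ?_⟩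
  have y1 := (hR x x1).trans_le (min_le_right _ _)
  have y2 := h.hpos (x + 1) (show a < x + 1 by linarith)
  rw [hξ']
  have : x + 1 - x = 1 := by ring
  rw [this, div_one]
  linarith

lemma tend_a (h : AuxSol k a c f F u u') : Tendsto u' (nhdsWithin a (Ioi a)) (nhds (u' a)) := by
  have cu : Continuous (fun r => u (max r a)) := by
    have : ContinuousOn (fun r => u (max r a)) univ :=
      h.hcont.comp (by fun_prop) (fun r _ => le_max_right r a)
    rwa [continuousOn_univ] at this
  have cg : Continuous (fun r => r ^ (k + 1) * f (u (max r a))) := by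
    have := h.hf.comp cu
    exact (continuous_pow _).mul this
  set g : ℝ → ℝ := fun r => ∫ t in a..r, t ^ (k + 1) * f (u (max t a)) with hg
  have dg : ∀ r, HasDerivAt g (r ^ (k + 1) * f (u (max r a))) r := fun r =>
    cg.integral_hasStrictDerivAt a r |>.hasDerivAt
  have dq : ∀ r ∈ Ioi a, HasDerivAt (fun r => r ^ (k + 1) * u' r + g r) 0 r := by
    intro r hr
    have hr' : a < r := hr
    have h0 : r ≠ 0 := (h.ha.trans hr').ne'
    have := (((hasDerivAt_id r).pow (k + 1)).mul (h.hdd r hr)).add (dg r)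
    refine this.congr_deriv ?_
    simp only [Pi.pow_apply, id, max_eq_left hr'.le, Nat.add_sub_cancel]
    push_cast
    field_simp
    ring
  have hconst : ∀ r ∈ Ioi a, r ^ (k + 1) * u' r + g r = c ^ (k + 1) * u' c + g c := by
    intro r hr
    exact isOpen_Ioi.is_const_of_deriv_eq_zero isPreconnected_Ioi
      (fun r hr => (dq r hr).differentiableAt.differentiableWithinAt)
      (fun r hr => (dq r hr).deriv) hr h.hac
  set C := c ^ (k + 1) * u' c + g c
  have t1 : Tendsto (fun r => (C - g r) / r ^ (k + 1)) (nhdsWithin a (Ioi a))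
      (nhds ((C - g a) / a ^ (k + 1))) := by
    have : ContinuousAt (fun r => (C - g r) / r ^ (k + 1)) a :=
      (continuousAt_const.sub (dg a).continuousAt).div (continuous_pow _).continuousAt
        (pow_ne_zero _ h.ha.ne')
    exact this.tendsto.mono_left nhdsWithin_le_nhds
  have t2 : Tendsto u' (nhdsWithin a (Ioi a)) (nhds ((C - g a) / a ^ (k + 1))) := by
    refine t1.congr' ?_
    filter_upwards [self_mem_nhdsWithin] with r hr
    have hr' : a < r := hr
    have := hconst r hr
    have h0 : r ^ (k + 1) ≠ 0 := pow_ne_zero _ (h.ha.trans hr').ne'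
    rw [div_eq_iff h0]
    linarith
  have t3 : HasDerivWithinAt u ((C - g a) / a ^ (k + 1)) (Ici a) a := by
    refine hasDerivWithinAt_Ici_of_tendsto_deriv (s := Ioi a)
      (fun r hr => (h.hd r hr).differentiableAt.differentiableWithinAt)
      ((h.hcont a ((self_mem_Ici : a ∈ Ici a))).mono Ioi_subset_Ici_self) self_mem_nhdsWithin ?_
    refine t2.congr' ?_
    filter_upwards [self_mem_nhdsWithin] with r hr using (h.hd r hr).deriv.symm
  have := (uniqueDiffOn_Ici a a ((self_mem_Ici : a ∈ Ici a))).eq_deriv _ h.hda t3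
  rw [this]
  exact t2

lemma smono (h : AuxSol k a c f F u u') : StrictMonoOn u (Icc a c) := by
  apply strictMonoOn_of_deriv_pos (convex_Icc _ _) (h.hcont.mono Icc_subset_Ici_self)
  rw [interior_Icc]
  intro r hr
  rw [(h.hd r hr.1).deriv]
  exact h.hup r ⟨hr.1.le, hr.2⟩

lemma santi (h : AuxSol k a c f F u u') : StrictAntiOn u (Ici c) := by
  apply strictAntiOn_of_deriv_neg (convex_Ici _)
    (h.hcont.mono (Ici_subset_Ici.2 h.hac.le))
  rw [interior_Ici]
  intro r hr
  rw [(h.hd r (h.hac.trans hr)).deriv]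
  exact h.hdown r hr

/-- derivative of an inverse branch -/
lemma dinv (h : AuxSol k a c f F u u') (ρ : ℝ → ℝ) (r : ℝ) (hr : a < r) (hne : u' r ≠ 0)
    (hinv : ∀ᶠ x in nhds r, ρ (u x) = x) :
    HasDerivAt ρ (u' r)⁻¹ (u r) ∧
    HasDerivAt (fun s => u' (ρ s)) (-(((k : ℝ) + 1) / r + f (u r) / u' r)) (u r) := by
  have hs : HasStrictDerivAt u (u' r) r := by
    apply hasStrictDerivAt_of_hasDerivAt_of_continuousAt
    · filter_upwards [Ioi_mem_nhds hr] with x hx using h.hd x hx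
    · exact (h.hdd r hr).continuousAt
  have h1 := (hs.to_local_left_inverse hne hinv).hasDerivAt
  refine ⟨h1, ?_⟩
  have h2 : ρ (u r) = r := hinv.self_of_nhds
  have h3 : HasDerivAt u' (-(((k : ℝ) + 1) / r * u' r + f (u r))) (ρ (u r)) := by
    rw [h2]; exact h.hdd r hr
  refine (h3.comp (u r) h1).congr_deriv ?_
  field_simp

/-- the increasing branch -/
lemma inc (h : AuxSol k a c f F u u') : ∃ ρ : ℝ → ℝ,
    (∀ r ∈ Icc a c, ρ (u r) = r) ∧
    (∀ s ∈ Ioo 0 (u c), ρ s ∈ Ioo a c ∧ u (ρ s) = s ∧ 0 < u' (ρ s) ∧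
      HasDerivAt ρ (1 / u' (ρ s)) s ∧
      HasDerivAt (fun s => u' (ρ s)) (-(((k : ℝ) + 1) / ρ s + f s / u' (ρ s))) s) ∧
    Tendsto ρ (nhdsWithin 0 (Ioi 0)) (nhdsWithin a (Ioi a)) := by
  have hinj := h.smono.injOn
  have hl : ∀ r ∈ Icc a c, Function.invFunOn u (Icc a c) (u r) = r :=
    fun r hr => hinj.leftInvOn_invFunOn hr
  have hmem : ∀ s ∈ Ioo 0 (u c), Function.invFunOn u (Icc a c) s ∈ Ioo a c ∧
      u (Function.invFunOn u (Icc a c) s) = s := by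
    intro s hs
    have hh : Ioo (u a) (u c) ⊆ u '' Ioo a c :=
      intermediate_value_Ioo h.hac.le (h.hcont.mono Icc_subset_Ici_self)
    rw [h.hua] at hh
    obtain ⟨r, hr, rfl⟩ := hh hs
    rw [hl r ⟨hr.1.le, hr.2.le⟩]
    exact ⟨hr, rfl⟩
  refine ⟨Function.invFunOn u (Icc a c), hl, ?_, ?_⟩
  · intro s hs
    obtain ⟨m1, m2⟩ := hmem s hs
    set ρ := Function.invFunOn u (Icc a c)
    have hp := h.hup (ρ s) ⟨m1.1.le, m1.2⟩
    have := h.dinv ρ (ρ s) m1.1 hp.ne' (by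
      filter_upwards [Ioo_mem_nhds m1.1 m1.2] with x hx using hl x ⟨hx.1.le, hx.2.le⟩)
    rw [m2] at this
    refine ⟨m1, m2, hp, ?_, this.2⟩
    rw [one_div]; exact this.1
  · have hMpos : 0 < u c := h.hpos c h.hac
    rw [tendsto_nhdsWithin_iff]
    constructor
    · rw [tendsto_order]
      constructor
      · intro x hx
        filter_upwards [Ioo_mem_nhdsGT hMpos] with s hs using hx.trans (hmem s hs).1.1
      · intro x hx
        set y := min x c with hy
        have hay : a < y := lt_min hx h.hac
        have hyc : y ≤ c := min_le_right _ _
        have huy : 0 < u y := h.hpos y hay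
        filter_upwards [Ioo_mem_nhdsGT hMpos, Ioo_mem_nhdsGT huy] with s hs hs'
        obtain ⟨m1, m2⟩ := hmem s hs
        have : Function.invFunOn u (Icc a c) s < y := by
          rw [← h.smono.lt_iff_lt ⟨m1.1.le, m1.2.le⟩ ⟨hay.le, hyc⟩, m2]
          exact hs'.2
        exact this.trans_le (min_le_left _ _)
    · filter_upwards [Ioo_mem_nhdsGT hMpos] with s hs using (hmem s hs).1.1

end AuxSol

lemma aux_M_lt (k : ℕ) (a c₁ c₂ β : ℝ) (f F u₁ u₁' u₂ u₂' : ℝ → ℝ)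
    (h₁ : AuxSol k a c₁ f F u₁ u₁') (h₂ : AuxSol k a c₂ f F u₂ u₂')
    (hβ0 : 0 < β) (hFn : ∀ s ∈ Icc 0 β, F s ≤ 0) (hFβ : F β = 0)
    (hfp : ∀ s, β ≤ s → 0 ≤ f s) (hslope : u₁' a < u₂' a) : u₁ c₁ < u₂ c₂ := by
  by_contra hcon
  push Not at hcon
  have hβM : β < u₂ c₂ := by
    by_contra hh
    push Not at hh
    have := hFn (u₂ c₂) ⟨(h₂.hpos c₂ h₂.hac).le, hh⟩
    linarith [h₂.FM]
  obtain ⟨ρ₁, l1, b1, t1⟩ := h₁.inc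
  obtain ⟨ρ₂, l2, b2, t2⟩ := h₂.inc
  have sub : ∀ s ∈ Ioo 0 (u₂ c₂), s ∈ Ioo 0 (u₁ c₁) := fun s hs => ⟨hs.1, hs.2.trans_le hcon⟩
  have hM2 : 0 < u₂ c₂ := hβ0.trans hβM
  have ha := h₁.ha
  -- choose the starting level
  have ex : ∃ s₁ ∈ Ioo 0 β, ρ₂ s₁ < ρ₁ s₁ ∧
      ρ₁ s₁ ^ (2 * k + 2) * (u₁' (ρ₁ s₁) ^ 2 / 2 + F s₁)
        < ρ₂ s₁ ^ (2 * k + 2) * (u₂' (ρ₂ s₁) ^ 2 / 2 + F s₁) := by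
    have lim : ∀ (ρ u u' : ℝ → ℝ) (c : ℝ), AuxSol k a c f F u u' →
        Tendsto ρ (nhdsWithin 0 (Ioi 0)) (nhdsWithin a (Ioi a)) →
        Tendsto (fun s => ρ s ^ (2 * k + 2) * (u' (ρ s) ^ 2 / 2 + F s)) (nhdsWithin 0 (Ioi 0))
          (nhds (a ^ (2 * k + 2) * (u' a ^ 2 / 2 + F 0))) := by
      intro ρ u u' c h t
      have A := (t.mono_right nhdsWithin_le_nhds).pow (2 * k + 2)
      have B := ((h.tend_a.comp t).pow 2).div_const 2
      have C : Tendsto F (nhdsWithin 0 (Ioi 0)) (nhds (F 0)) :=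
        (h.hF 0).continuousAt.tendsto.mono_left nhdsWithin_le_nhds
      exact A.mul (B.add C)
    have L1 := lim ρ₁ u₁ u₁' c₁ h₁ t1
    have L2 := lim ρ₂ u₂ u₂' c₂ h₂ t2
    have hp1 : 0 < u₁' a := h₁.hup a ⟨le_rfl, h₁.hac⟩
    have hlt : a ^ (2 * k + 2) * (u₁' a ^ 2 / 2 + F 0) < a ^ (2 * k + 2) * (u₂' a ^ 2 / 2 + F 0) := by
      gcongr
    have E1 := L1.eventually_lt L2 hlt
    have E2 : ∀ᶠ r in nhdsWithin a (Ioi a), u₁ r < u₂ r := by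
      have hd := h₂.hda.sub h₁.hda
      have hd' := hasDerivWithinAt_iff_tendsto_slope.1 hd
      have hS : Ici a \ {a} = Ioi a := by simp
      rw [hS] at hd'
      have := hd'.eventually (Ioi_mem_nhds (show (0:ℝ) < u₂' a - u₁' a by linarith))
      filter_upwards [this, self_mem_nhdsWithin] with r hr hr'
      have hr'' : a < r := hr'
      have hr3 : 0 < slope (u₂ - u₁) a r := hr
      rw [slope_def_field] at hr3
      have h5 : 0 < r - a := by linarith
      have := (div_pos_iff_of_pos_right h5).1 hr3
      simp only [Pi.sub_apply, h₁.hua, h₂.hua] at this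
      linarith
    have E3 := t1.eventually E2
    have E4 : ∀ᶠ s in nhdsWithin 0 (Ioi 0), ρ₁ s < c₂ :=
      (t1.mono_right nhdsWithin_le_nhds).eventually (Iio_mem_nhds h₂.hac)
    obtain ⟨s, hs1, hs3, hs4, hs5⟩ := (E1.and (E3.and (E4.and (Ioo_mem_nhdsGT hβ0)))).exists
    refine ⟨s, hs5, ?_, hs1⟩
    have hsm : s ∈ Ioo 0 (u₂ c₂) := ⟨hs5.1, hs5.2.trans hβM⟩
    obtain ⟨m2, m2', -⟩ := b2 s hsm
    obtain ⟨m1, m1', -⟩ := b1 s (sub s hsm)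
    rw [← h₂.smono.lt_iff_lt ⟨m2.1.le, m2.2.le⟩ ⟨m1.1.le, hs4.le⟩, m2']
    rwa [m1'] at hs3
  obtain ⟨s₁, hs₁, hr, he⟩ := ex
  obtain ⟨η, hη, hall⟩ := aux_inc k f F ρ₁ (fun s => u₁' (ρ₁ s)) ρ₂ (fun s => u₂' (ρ₂ s)) (u₂ c₂) β s₁
    (fun s _ => h₁.hF s) hβM (fun s hs => hFn s ⟨hs.1.le, hs.2⟩) hFβ hfp
    (fun s hs => ha.trans (b1 s (sub s hs)).1.1) (fun s hs => ha.trans (b2 s hs).1.1)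
    (fun s hs => (b1 s (sub s hs)).2.2.1) (fun s hs => (b2 s hs).2.2.1)
    (fun s hs => (b1 s (sub s hs)).2.2.2.1) (fun s hs => (b2 s hs).2.2.2.1)
    (fun s hs => (b1 s (sub s hs)).2.2.2.2) (fun s hs => (b2 s hs).2.2.2.2)
    (fun s hs => by
      have := b1 s (sub s hs)
      have h5 := h₁.Enonneg (ρ₁ s) this.1.1
      rwa [this.2.1] at h5)
    hs₁ hr he
  -- contradiction at the maximum
  have hc : ContinuousAt (fun r => r ^ (2 * k + 2) * u₂' r ^ 2) c₂ :=
    (continuous_pow _).continuousAt.mul ((h₂.hdd c₂ h₂.hac).continuousAt.pow 2)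
  have h0 : (fun r => r ^ (2 * k + 2) * u₂' r ^ 2) c₂ < η := by simp [h₂.uc, hη]
  have G1 : ∀ᶠ r in nhdsWithin c₂ (Iio c₂), r ^ (2 * k + 2) * u₂' r ^ 2 < η :=
    (hc.tendsto.mono_left nhdsWithin_le_nhds).eventually (Iio_mem_nhds h0)
  have G2 : ∀ᶠ r in nhdsWithin c₂ (Iio c₂), β < u₂ r :=
    ((h₂.hd c₂ h₂.hac).continuousAt.tendsto.mono_left nhdsWithin_le_nhds).eventually
      (Ioi_mem_nhds hβM)
  obtain ⟨r, g1, g2, g3⟩ := (G1.and (G2.and (Ioo_mem_nhdsLT h₂.hac))).exists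
  have hrm : r ∈ Icc a c₂ := ⟨g3.1.le, g3.2.le⟩
  have := hall (u₂ r) ⟨g2, h₂.smono hrm ⟨h₂.hac.le, le_rfl⟩ g3.2⟩
  simp only [l2 r hrm] at this
  linarith

lemma aux_main (k : ℕ) (a c₁ c₂ β B : ℝ) (f F u₁ u₁' u₂ u₂' : ℝ → ℝ)
    (h₁ : AuxSol k a c₁ f F u₁ u₁') (h₂ : AuxSol k a c₂ f F u₂ u₂')
    (hB : 0 < B) (hBβ : B < β) (hfn : ∀ s ∈ Icc 0 B, f s ≤ 0) (hfp : ∀ s, B < s → 0 < f s)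
    (hFβ : F β = 0) (hslope : u₁' a < u₂' a) (rb₁ rb₂ : ℝ → ℝ)
    (hrb₁mem : ∀ s ∈ Ioc (0:ℝ) (u₁ c₁), rb₁ s ∈ Ici c₁ ∧ u₁ (rb₁ s) = s)
    (hrb₁inv : ∀ r ∈ Ici c₁, rb₁ (u₁ r) = r)
    (hrb₂mem : ∀ s ∈ Ioc (0:ℝ) (u₂ c₂), rb₂ s ∈ Ici c₂ ∧ u₂ (rb₂ s) = s)
    (hrb₂inv : ∀ r ∈ Ici c₂, rb₂ (u₂ r) = r)
    (hlt : rb₁ (u₁ c₁) < rb₂ (u₁ c₁)) :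
    ∃ s ∈ Ioo (0:ℝ) (u₁ c₁), rb₁ s = rb₂ s := by
  have hF := h₁.hF
  have hFn : ∀ s ∈ Icc 0 β, F s ≤ 0 := by
    intro s hs
    rcases le_total s B with hsB | hsB
    · have : AntitoneOn F (Icc 0 B) := by
        apply antitoneOn_of_deriv_nonpos (convex_Icc _ _)
        · exact fun s _ => (hF s).continuousAt.continuousWithinAt
        · exact fun s _ => (hF s).differentiableAt.differentiableWithinAt
        · rw [interior_Icc]
          intro s hs
          rw [(hF s).deriv]
          exact hfn s ⟨hs.1.le, hs.2.le⟩
      have := this ⟨le_rfl, hB.le⟩ ⟨hs.1, hsB⟩ hs.1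
      rwa [h₁.hF0] at this
    · have : MonotoneOn F (Icc B β) := by
        apply monotoneOn_of_deriv_nonneg (convex_Icc _ _)
        · exact fun s _ => (hF s).continuousAt.continuousWithinAt
        · exact fun s _ => (hF s).differentiableAt.differentiableWithinAt
        · rw [interior_Icc]
          intro s hs
          rw [(hF s).deriv]
          exact (hfp s hs.1).le
      have := this ⟨hsB, hs.2⟩ ⟨hBβ.le, le_rfl⟩ hs.2
      rwa [hFβ] at this
  have hβ0 : 0 < β := hB.trans hBβ
  have hM : u₁ c₁ < u₂ c₂ := aux_M_lt k a c₁ c₂ β f F u₁ u₁' u₂ u₂' h₁ h₂ hβ0 hFn hFβ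
    (fun s hs => (hfp s (hBβ.trans_le hs)).le) hslope
  have hM1 : 0 < u₁ c₁ := h₁.hpos c₁ h₁.hac
  have hβM : β < u₁ c₁ := by
    by_contra hh
    push Not at hh
    have := hFn (u₁ c₁) ⟨hM1.le, hh⟩
    linarith [h₁.FM]
  have br : ∀ (c : ℝ) (u u' rb : ℝ → ℝ), AuxSol k a c f F u u' →
      (∀ s ∈ Ioc (0:ℝ) (u c), rb s ∈ Ici c ∧ u (rb s) = s) →
      (∀ r ∈ Ici c, rb (u r) = r) → ∀ s ∈ Ioo 0 (u c),
      0 < rb s ∧ 0 < -u' (rb s) ∧ HasDerivAt rb (-(1 / -u' (rb s))) s ∧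
      HasDerivAt (fun s => -u' (rb s)) (((k : ℝ) + 1) / rb s - f s / -u' (rb s)) s := by
    intro c u u' rb h hm hi s hs
    obtain ⟨m1, m2⟩ := hm s ⟨hs.1, hs.2.le⟩
    have m3 : c < rb s := by
      rcases eq_or_lt_of_le (show c ≤ rb s from m1) with h5 | h5
      · rw [← h5] at m2
        linarith [hs.2]
      · exact h5
    have m4 := h.hdown (rb s) m3
    have hac := h.hac
    have := h.dinv rb (rb s) (hac.trans m3) m4.ne (by
      filter_upwards [Ioi_mem_nhds m3] with x hx using hi x (mem_Ici.2 (le_of_lt (mem_Ioi.1 hx))))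
    rw [m2] at this
    refine ⟨h.ha.trans (hac.trans m3), by linarith, this.1.congr_deriv ?_,
      this.2.neg.congr_deriv ?_⟩
    · rw [one_div, inv_neg, neg_neg]
    · rw [div_neg]; ring
  have br1 := br c₁ u₁ u₁' rb₁ h₁ hrb₁mem hrb₁inv
  have br2' := br c₂ u₂ u₂' rb₂ h₂ hrb₂mem hrb₂inv
  have br2 := fun s (hs : s ∈ Ioo 0 (u₁ c₁)) => br2' s ⟨hs.1, hs.2.trans hM⟩
  have rb1c : rb₁ (u₁ c₁) = c₁ := hrb₁inv c₁ self_mem_Ici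
  by_contra hcon
  push Not at hcon
  -- some point with `rb₁ < rb₂`
  have ex : ∃ s ∈ Ioo 0 (u₁ c₁), rb₁ s < rb₂ s := by
    have hc2 : ContinuousAt rb₂ (u₁ c₁) := (br2' (u₁ c₁) ⟨hM1, hM⟩).2.2.1.continuousAt
    have hc1 : ContinuousAt u₁ c₁ := (h₁.hd c₁ h₁.hac).continuousAt
    have hc3 : ContinuousAt (fun r => rb₂ (u₁ r)) c₁ := ContinuousAt.comp (f := u₁) hc2 hc1
    have h5 : ∀ᶠ r in nhds c₁, r < rb₂ (u₁ r) :=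
      continuousAt_id.eventually_lt hc3 (by simpa [rb1c] using hlt)
    obtain ⟨r, g1, g2⟩ := ((h5.filter_mono (nhdsWithin_le_nhds (s := Ioi c₁))).and
      (self_mem_nhdsWithin : Ioi c₁ ∈ nhdsWithin c₁ (Ioi c₁))).exists
    have g2' : c₁ < r := g2
    refine ⟨u₁ r, ⟨h₁.hpos r (h₁.hac.trans g2'), h₁.santi self_mem_Ici g2'.le g2'⟩, ?_⟩
    rw [hrb₁inv r g2'.le]
    exact g1
  obtain ⟨s₀, hs₀, hlt₀⟩ := ex
  have all : ∀ s ∈ Ioo 0 (u₁ c₁), rb₁ s < rb₂ s := by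
    intro s hs
    by_contra hge
    push Not at hge
    obtain ⟨t, ht, ht'⟩ := isPreconnected_Ioo.intermediate_value₂ hs₀ hs
      (fun x hx => (br1 x hx).2.2.1.continuousAt.continuousWithinAt)
      (fun x hx => (br2 x hx).2.2.1.continuousAt.continuousWithinAt) hlt₀.le hge
    exact hcon t ht ht'
  obtain ⟨η, hη, hall⟩ := aux_dec k f rb₁ (fun s => -u₁' (rb₁ s)) rb₂ (fun s => -u₂' (rb₂ s))
    (u₁ c₁) B hB (hBβ.trans hβM) (fun s hs => hfn s ⟨hs.1.le, hs.2⟩)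
    (fun s hs => (br1 s hs).1) all (fun s hs => (br1 s hs).2.1) (fun s hs => (br2 s hs).2.1)
    (fun s hs => (br1 s hs).2.2.1) (fun s hs => (br2 s hs).2.2.1)
    (fun s hs => (br1 s hs).2.2.2) (fun s hs => (br2 s hs).2.2.2)
    (by
      intro η hη δ hδ
      obtain ⟨r, x1, x2, x3, x4⟩ := h₂.liminf η hη δ hδ
      refine ⟨u₂ r, ⟨h₂.hpos r (h₂.hac.trans x1), x3⟩, ?_⟩
      simp only [hrb₂inv r x1.le]
      exact ⟨x4, x2⟩)
  have hc : ContinuousAt (fun r => (-u₁' r) ^ 2) c₁ :=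
    (h₁.hdd c₁ h₁.hac).continuousAt.neg.pow 2
  have h0 : (fun r => (-u₁' r) ^ 2) c₁ < η := by simp [h₁.uc, hη]
  have G1 : ∀ᶠ r in nhdsWithin c₁ (Ioi c₁), (-u₁' r) ^ 2 < η :=
    (hc.tendsto.mono_left nhdsWithin_le_nhds).eventually (Iio_mem_nhds h0)
  have G2 : ∀ᶠ r in nhdsWithin c₁ (Ioi c₁), B < u₁ r :=
    ((h₁.hd c₁ h₁.hac).continuousAt.tendsto.mono_left nhdsWithin_le_nhds).eventually
      (Ioi_mem_nhds (hBβ.trans hβM))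
  obtain ⟨r, g1, g2, g3⟩ := (G1.and (G2.and
      (self_mem_nhdsWithin : Ioi c₁ ∈ nhdsWithin c₁ (Ioi c₁)))).exists
  have g3' : c₁ < r := g3
  have := hall (u₁ r) ⟨g2, h₁.santi self_mem_Ici g3'.le g3'⟩
  simp only [hrb₁inv r g3'.le] at this
  linarith

/-- Step six for the exterior problem (Proposition 4.1): under (f1)–(f3) with `B > 0`,
if `r̄₁(M₁) < r̄₂(M₁)` then `r̄₁` and `r̄₂` intersect in `(0, M₁)`. -/
theorem step_six_exterior
    (n : ℕ) (hn : 2 ≤ n) (f : ℝ → ℝ) (β B : ℝ)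
    (hf1 : CondF1 f) (hf2 : CondF2B f β B) (hf3 : CondF3 n f β)
    (a : ℝ) (ha : 0 < a)
    (u₁ u₁' u₂ u₂' : ℝ → ℝ)
    (h₁ : IsPosSolExt n a f u₁ u₁') (h₂ : IsPosSolExt n a f u₂ u₂')
    (hslope₁ : 0 < u₁' a) (hslope₁₂ : u₁' a < u₂' a)
    (c₁ c₂ : ℝ) (hc₁ : a < c₁) (hc₂ : a < c₂)
    (hc₁up : ∀ r ∈ Ico a c₁, 0 < u₁' r) (hc₁down : ∀ r ∈ Ioi c₁, u₁' r < 0)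
    (hc₂up : ∀ r ∈ Ico a c₂, 0 < u₂' r) (hc₂down : ∀ r ∈ Ioi c₂, u₂' r < 0)
    (M₁ M₂ : ℝ) (hM₁ : M₁ = u₁ c₁) (hM₂ : M₂ = u₂ c₂)
    (rb₁ rb₂ : ℝ → ℝ)
    (hrb₁mem : ∀ s ∈ Ioc (0:ℝ) M₁, rb₁ s ∈ Ici c₁ ∧ u₁ (rb₁ s) = s)
    (hrb₁inv : ∀ r ∈ Ici c₁, rb₁ (u₁ r) = r)
    (hrb₂mem : ∀ s ∈ Ioc (0:ℝ) M₂, rb₂ s ∈ Ici c₂ ∧ u₂ (rb₂ s) = s)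
    (hrb₂inv : ∀ r ∈ Ici c₂, rb₂ (u₂ r) = r)
    (hlt : rb₁ M₁ < rb₂ M₁) :
    ∃ s ∈ Ioo (0:ℝ) M₁, rb₁ s = rb₂ s := by
  obtain ⟨k, rfl⟩ : ∃ k, n = k + 2 := ⟨n - 2, by omega⟩
  obtain ⟨hf0, hB, hBβ, hfp, hfn, -, hFβ⟩ := hf2
  have hfc : Continuous (fun t => f (max t 0)) := by
    have : ContinuousOn (fun t => f (max t 0)) univ :=
      hf1.1.comp (by fun_prop) (fun r _ => le_max_right r 0)
    rwa [continuousOn_univ] at this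
  have mk : ∀ (u u' : ℝ → ℝ) (c : ℝ), IsPosSolExt (k + 2) a f u u' → a < c →
      (∀ r ∈ Ico a c, 0 < u' r) → (∀ r ∈ Ioi c, u' r < 0) →
      AuxSol k a c (fun t => f (max t 0)) (fun s => ∫ t in (0:ℝ)..s, f (max t 0)) u u' := by
    intro u u' c h hc hup hdown
    obtain ⟨i1, i2, i3, i4, i5, i6, i7⟩ := h
    refine ⟨ha, hc, hfc, fun s => (hfc.integral_hasStrictDerivAt 0 s).hasDerivAt, by simp, i1,
      i2 a self_mem_Ici, i3, ?_, i5, i6, i7, hup, hdown⟩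
    intro r hr
    refine (i4 r hr).congr_deriv ?_
    rw [max_eq_left (i6 r hr).le]
    push_cast
    ring
  subst hM₁ hM₂
  refine aux_main k a c₁ c₂ β B _ _ u₁ u₁' u₂ u₂' (mk u₁ u₁' c₁ h₁ hc₁ hc₁up hc₁down)
    (mk u₂ u₂' c₂ h₂ hc₂ hc₂up hc₂down) hB hBβ ?_ ?_ ?_ hslope₁₂ rb₁ rb₂ hrb₁mem hrb₁inv
    hrb₂mem hrb₂inv hlt
  · intro s hs
    simpa [max_eq_left hs.1] using hfn s hs
  · intro s hs
    simpa [max_eq_left (hB.trans hs).le] using hfp s hs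
  · refine Eq.trans ?_ hFβ
    rw [Fint]
    apply intervalIntegral.integral_congr
    intro t ht
    rw [uIcc_of_le (hB.trans hBβ).le] at ht
    simp [max_eq_left ht.1]
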